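/- Let N ≥ 2 be an integer, γ > 0 and ω > γ²/N², and set φ(x) = √(2ω) · sech(√ω·x + artanh(γ/(N√ω))). Then N·∫_0^∞ φ′(x)² dx − (N/2)·∫_0^∞ φ(x)⁴ dx − γ·φ(0)² = −(2/3)·( N·ω^{3/2} − γ³/N² ). -/

import Mathlib

open MeasureTheory

noncomputable section

/-- The inverse hyperbolic tangent. -/
def artanh (x : ℝ) : ℝ := (1/2) * Real.log ((1+x)/(1-x))

open Filter Topology

theorem artanh_eq_real_artanh {x : ℝ} (hx : x ∈ Set.Icc (-1) 1) : artanh x = Real.artanh x :=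
  (Real.artanh_eq_half_log hx).symm

theorem one_sub_tanh_sq (x : ℝ) : 1 - Real.tanh x ^ 2 = (Real.cosh x)⁻¹ ^ 2 := by
  have hc := (Real.cosh_pos x).ne'
  rw [Real.tanh_eq_sinh_div_cosh]
  field_simp
  linarith [Real.cosh_sq x]

theorem hasDerivAt_tanh (x : ℝ) : HasDerivAt Real.tanh (1 - Real.tanh x ^ 2) x := by
  have hc := (Real.cosh_pos x).ne'
  have h := (Real.hasDerivAt_sinh x).div (Real.hasDerivAt_cosh x) hc
  have he : Real.tanh = Real.sinh / Real.cosh := funext Real.tanh_eq_sinh_div_cosh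
  rw [he]
  refine h.congr_deriv ?_
  simp only [Pi.div_apply]
  field_simp

theorem tendsto_tanh_atTop : Tendsto Real.tanh atTop (𝓝 1) := by
  have he : Tendsto (fun x : ℝ => Real.exp (-x)) atTop (𝓝 0) := Real.tendsto_exp_neg_atTop_nhds_zero
  have h : Tendsto (fun x : ℝ => (1 - Real.exp (-x) ^ 2) / (1 + Real.exp (-x) ^ 2)) atTop
      (𝓝 ((1 - 0 ^ 2) / (1 + 0 ^ 2))) :=
    ((he.pow 2).const_sub 1).div ((he.pow 2).const_add 1) (by norm_num)
  have h1 : ((1 - 0 ^ 2) / (1 + 0 ^ 2) : ℝ) = 1 := by norm_num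
  rw [h1] at h
  refine h.congr fun x => ?_
  have hx := Real.exp_pos x
  rw [Real.tanh_eq, Real.exp_neg]
  field_simp

section AffineTanh

variable {s : ℝ} (a : ℝ)

theorem hasDerivAt_tanh_affine (s a x : ℝ) :
    HasDerivAt (fun y => Real.tanh (s * y + a)) (s * (1 - Real.tanh (s * x + a) ^ 2)) x := by
  have h := (hasDerivAt_tanh (s * x + a)).comp x (((hasDerivAt_id x).const_mul s).add_const a)
  exact h.congr_deriv (by simp [mul_comm])

theorem tendsto_tanh_affine_atTop (hs : 0 < s) :
    Tendsto (fun y => Real.tanh (s * y + a)) atTop (𝓝 1) :=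
  tendsto_tanh_atTop.comp (tendsto_atTop_add_const_right _ a (tendsto_id.const_mul_atTop hs))

theorem integral_Ioi_tanh_sq_mul_sech_sq (hs : 0 < s) :
    ∫ x in Set.Ioi (0 : ℝ), Real.tanh (s * x + a) ^ 2 * (1 - Real.tanh (s * x + a) ^ 2) =
      (1 - Real.tanh a ^ 3) / (3 * s) := by
  have hd (x : ℝ) : HasDerivAt (fun y => Real.tanh (s * y + a) ^ 3 / (3 * s))
      (Real.tanh (s * x + a) ^ 2 * (1 - Real.tanh (s * x + a) ^ 2)) x := by
    refine (((hasDerivAt_tanh_affine s a x).fun_pow 3).div_const (3 * s)).congr_deriv ?_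
    push_cast
    field_simp
  have hl := ((tendsto_tanh_affine_atTop a hs).pow 3).div_const (3 * s)
  rw [integral_Ioi_of_hasDerivAt_of_nonneg' (fun x _ => hd x)
    (fun x _ => mul_nonneg (sq_nonneg _) (by linarith [Real.tanh_sq_lt_one (s * x + a)])) hl]
  simp only [mul_zero, zero_add]
  ring

theorem integral_Ioi_sech_pow_four (hs : 0 < s) :
    ∫ x in Set.Ioi (0 : ℝ), (1 - Real.tanh (s * x + a) ^ 2) ^ 2 =
      (2 / 3 - Real.tanh a + Real.tanh a ^ 3 / 3) / s := by
  have hd (x : ℝ) : HasDerivAt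
      (fun y => (Real.tanh (s * y + a) - Real.tanh (s * y + a) ^ 3 / 3) / s)
      ((1 - Real.tanh (s * x + a) ^ 2) ^ 2) x := by
    have h := hasDerivAt_tanh_affine s a x
    refine ((h.fun_sub ((h.fun_pow 3).div_const 3)).div_const s).congr_deriv ?_
    push_cast
    field_simp
  have ht := tendsto_tanh_affine_atTop a hs
  have hl := (ht.sub ((ht.pow 3).div_const 3)).div_const s
  rw [integral_Ioi_of_hasDerivAt_of_nonneg' (fun x _ => hd x) (fun x _ => sq_nonneg _) hl]
  simp only [mul_zero, zero_add]
  ring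

theorem hasDerivAt_const_mul_sech_affine (c s a x : ℝ) :
    HasDerivAt (fun y => c * (Real.cosh (s * y + a))⁻¹)
      (-(c * s * Real.tanh (s * x + a) * (Real.cosh (s * x + a))⁻¹)) x := by
  have hc := (Real.cosh_pos (s * x + a)).ne'
  have h := (Real.hasDerivAt_cosh (s * x + a)).comp x
    (((hasDerivAt_id x).const_mul s).add_const a)
  refine ((h.fun_inv hc).const_mul c).congr_deriv ?_
  simp only [Function.comp_apply, id_eq]
  rw [Real.tanh_eq_sinh_div_cosh]
  field_simp

end AffineTanh

/-- Energy identity for the half-soliton profile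
`φ(x) = √(2ω)·sech(√ω·x + artanh(γ/(N√ω)))`:
`N·∫₀^∞ φ′² − (N/2)·∫₀^∞ φ⁴ − γ·φ(0)² = −(2/3)·(N·ω^{3/2} − γ³/N²)`. -/
theorem soliton_energy_identity (N : ℕ) (hN : 2 ≤ N) (γ ω : ℝ)
    (hγ : 0 < γ) (hω : γ ^ 2 / (N : ℝ) ^ 2 < ω) (φ : ℝ → ℝ)
    (hφ : ∀ x, φ x = Real.sqrt (2 * ω) *
      (Real.cosh (Real.sqrt ω * x + artanh (γ / ((N : ℝ) * Real.sqrt ω))))⁻¹) :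
    (N : ℝ) * (∫ x in Set.Ioi (0:ℝ), (deriv φ x) ^ 2)
      - (N : ℝ) / 2 * (∫ x in Set.Ioi (0:ℝ), (φ x) ^ 4)
      - γ * (φ 0) ^ 2
      = -(2/3) * ((N : ℝ) * ω ^ ((3:ℝ)/2) - γ ^ 3 / (N : ℝ) ^ 2) := by
  have hNpos : (0 : ℝ) < N := by exact_mod_cast (by omega : 0 < N)
  have hωpos : 0 < ω := lt_of_le_of_lt (by positivity) hω
  obtain ⟨s, hs_def⟩ : ∃ s, s = Real.sqrt ω := ⟨_, rfl⟩
  have hs : 0 < s := hs_def ▸ Real.sqrt_pos.mpr hωpos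
  have hsω : ω = s ^ 2 := by rw [hs_def, Real.sq_sqrt hωpos.le]
  have hpow : ω ^ ((3 : ℝ) / 2) = s ^ 3 := by
    rw [hs_def, Real.sqrt_eq_rpow, ← Real.rpow_natCast, ← Real.rpow_mul hωpos.le]
    norm_num
  rw [← hs_def] at hφ
  obtain ⟨t, ht⟩ : ∃ t, t = γ / (N * s) := ⟨_, rfl⟩
  obtain ⟨a, ha⟩ : ∃ a, a = artanh t := ⟨_, rfl⟩
  rw [← ht, ← ha] at hφ
  have hγt : γ = N * s * t := by rw [ht]; field_simp
  have ht0 : 0 < t := by rw [ht]; positivity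
  have ht1 : t < 1 := by
    rw [hsω, ← div_pow] at hω
    rw [ht, ← div_div, div_lt_one hs]
    exact lt_of_pow_lt_pow_left₀ 2 hs.le hω
  have hta : Real.tanh a = t := by
    rw [ha, artanh_eq_real_artanh ⟨by linarith, ht1.le⟩,
      Real.tanh_artanh ⟨by linarith, ht1⟩]
  have hc2 : Real.sqrt (2 * ω) ^ 2 = 2 * s ^ 2 := by
    rw [Real.sq_sqrt (by positivity), hsω]
  have hφ2 (x : ℝ) : φ x ^ 2 = 2 * s ^ 2 * (1 - Real.tanh (s * x + a) ^ 2) := by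
    rw [hφ, mul_pow, hc2, one_sub_tanh_sq]
  have hφ4 (x : ℝ) : φ x ^ 4 = 4 * s ^ 4 * (1 - Real.tanh (s * x + a) ^ 2) ^ 2 := by
    rw [show φ x ^ 4 = (φ x ^ 2) ^ 2 by ring, hφ2]
    ring
  have h_deriv_sq (x : ℝ) : deriv φ x ^ 2 =
      2 * s ^ 4 * (Real.tanh (s * x + a) ^ 2 * (1 - Real.tanh (s * x + a) ^ 2)) := by
    rw [funext hφ, (hasDerivAt_const_mul_sech_affine _ s a x).deriv, one_sub_tanh_sq, neg_sq,
      mul_pow, mul_pow, mul_pow, hc2]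
    ring
  simp only [hφ4, h_deriv_sq, hφ2]
  rw [integral_const_mul, integral_const_mul, integral_Ioi_tanh_sq_mul_sech_sq a hs,
    integral_Ioi_sech_pow_four a hs, mul_zero, zero_add, hta, hpow, hγt]
  field_simp
  ring
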